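/- If C ∈ K[[y]] is a power series of the form C = 1 + Σ_{i≥1} c_i u^{−2i} y^{3i} with c_i ∈ ℂ, and C satisfies S_y² C = y^{−2} C as formal Laurent series in y over K, then C = A. In other words, A is the unique solution of this equation among series of this form. -/

import Mathlib

noncomputable section

/-- The base field `K = ℂ(u)`, rational functions in the variable `u`. -/
abbrev K : Type := RatFunc ℂ

/-- The variable `u ∈ K`. -/
def u : K := RatFunc.X

/-- The formal derivative `∂_y` of a formal Laurent series in `y` over `K`. -/
def derivLS (f : LaurentSeries K) : LaurentSeries K where
  coeff := fun n => ((n + 1 : ℤ) : K) * f.coeff (n + 1)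
  isPWO_support' := by
    refine ((f.isPWO_support.add (Set.isPWO_singleton (-1 : ℤ))).mono ?_)
    intro n hn
    simp only [Function.mem_support, ne_eq] at hn
    have hf : f.coeff (n + 1) ≠ 0 := fun h => hn (by simp [h])
    rw [Set.add_singleton]
    exact ⟨n + 1, by simpa [HahnSeries.mem_support] using hf, by ring⟩

/-- Multiplication of a formal Laurent series by `y^k`. -/
def ySh (k : ℤ) (f : LaurentSeries K) : LaurentSeries K :=
  (HahnSeries.single k (1 : K)) * f

/-- The operator `S_y f = u⁻² y³ ∂_y f + (1/2) u⁻² y² f + y⁻¹ f`. -/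
def Sy (f : LaurentSeries K) : LaurentSeries K :=
  (u⁻¹ ^ 2) • ySh 3 (derivLS f) + ((1 / 2 : K) * u⁻¹ ^ 2) • ySh 2 f + ySh (-1) f

/-- `a_n = (-1)^n (6n)! / (288^n (2n)! (3n)!)`. -/
def aQ (n : ℕ) : ℚ :=
  (-1) ^ n * ((6 * n).factorial : ℚ) /
    (288 ^ n * ((2 * n).factorial : ℚ) * ((3 * n).factorial : ℚ))

/-- The power-series-in-`y` `Σ_{n ≥ 0} c_n u^{-2n} y^{3n}` (viewed as a Laurent series)
attached to rational coefficients `c : ℕ → ℚ`. -/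
def mkS (c : ℕ → ℚ) : LaurentSeries K :=
  HahnSeries.ofPowerSeries ℤ K
    (PowerSeries.mk fun m => if 3 ∣ m then ((c (m / 3) : ℚ) : K) * u⁻¹ ^ (2 * (m / 3)) else 0)

/-- The series `A = Σ_{n ≥ 0} a_n u^{-2n} y^{3n}`. -/
def A : LaurentSeries K := mkS aQ

/-- Coefficients of `y^k f`. -/
lemma coeff_ySh (k n : ℤ) (f : LaurentSeries K) : (ySh k f).coeff n = f.coeff (n - k) := by
  have h := HahnSeries.coeff_single_mul_add (r := (1 : K)) (x := f) (a := n - k) (b := k)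
  simpa [ySh] using h

/-- Coefficients of `S_y f`. -/
lemma coeff_Sy (f : LaurentSeries K) (n : ℤ) :
    (Sy f).coeff n = u⁻¹ ^ 2 * ((n : K) - 3 / 2) * f.coeff (n - 2) + f.coeff (n + 1) := by
  have h : (derivLS f).coeff (n - 3) = ((n : K) - 2) * f.coeff (n - 2) := by
    have h3 : n - 3 + 1 = n - 2 := by ring
    simp only [derivLS, h3]
    push_cast
    ring
  simp only [Sy, HahnSeries.coeff_add, HahnSeries.coeff_smul, coeff_ySh, h, smul_eq_mul,
    sub_neg_eq_add]
  ring

/-- The equation `S_y² f = y⁻² f` as a recurrence on coefficients. -/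
lemma coeff_recurrence {f : LaurentSeries K} (hf : Sy (Sy f) = ySh (-2) f) (n : ℤ) :
    u⁻¹ ^ 2 * ((n : K) + 5 / 2) * ((n : K) + 1 / 2) * f.coeff n
      + 2 * ((n : K) + 3) * f.coeff (n + 3) = 0 := by
  have hu : (u⁻¹ ^ 2 : K) ≠ 0 := pow_ne_zero _ (inv_ne_zero RatFunc.X_ne_zero)
  have h := congrArg (fun g => HahnSeries.coeff g (n + 4)) hf
  have e1 : n + 4 - 2 - 2 = n := by ring
  have e2 : n + 4 - 2 + 1 = n + 3 := by ring
  have e3 : n + 4 + 1 - 2 = n + 3 := by ring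
  have e4 : n + 4 + 1 + 1 = n + 6 := by ring
  have e5 : n + 4 - -2 = n + 6 := by ring
  simp only [coeff_Sy, coeff_ySh, e1, e2, e3, e4, e5] at h
  push_cast at h
  apply mul_left_cancel₀ hu
  linear_combination h

lemma aQ_succ (k : ℕ) :
    aQ (k + 1) = -((6 * k + 5) * (6 * k + 1) / (24 * (k + 1))) * aQ k := by
  have h6 : 6 * (k + 1) = 6 * k + 1 + 1 + 1 + 1 + 1 + 1 := by ring
  have h2 : 2 * (k + 1) = 2 * k + 1 + 1 := by ring
  have h3 : 3 * (k + 1) = 3 * k + 1 + 1 + 1 := by ring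
  simp only [aQ, h6, h2, h3, Nat.factorial_succ]
  push_cast
  have f2 : ((2 * k).factorial : ℚ) ≠ 0 := by positivity
  have f3 : ((3 * k).factorial : ℚ) ≠ 0 := by positivity
  have g1 : (k : ℚ) + 1 ≠ 0 := by positivity
  have g2 : (2 * k : ℚ) + 1 ≠ 0 := by positivity
  have g3 : (2 * k : ℚ) + 1 + 1 ≠ 0 := by positivity
  have g4 : (3 * k : ℚ) + 1 ≠ 0 := by positivity
  have g5 : (3 * k : ℚ) + 1 + 1 ≠ 0 := by positivity
  have g6 : (3 * k : ℚ) + 1 + 1 + 1 ≠ 0 := by positivity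
  rw [← mul_div_assoc, div_eq_div_iff (by positivity) (by positivity)]
  field_simp
  ring

/-- The coefficient of `y^{3k}` in a series `Σ c_i u^{-2i} y^{3i}`. -/
lemma coeff_three_mul (c : ℕ → ℂ) (k : ℕ) :
    (HahnSeries.ofPowerSeries ℤ K
      (PowerSeries.mk fun m =>
        if 3 ∣ m then algebraMap ℂ K (c (m / 3)) * u⁻¹ ^ (2 * (m / 3)) else 0)).coeff
      (3 * (k : ℤ)) = algebraMap ℂ K (c k) * u⁻¹ ^ (2 * k) := by
  have h : (3 * (k : ℤ)) = ((3 * k : ℕ) : ℤ) := by push_cast; rfl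
  rw [h, HahnSeries.ofPowerSeries_apply_coeff]
  simp

/-- `A` is the unique solution of `S_y² C = y⁻² C` among power series of the form
`C = 1 + Σ_{i≥1} c_i u^{-2i} y^{3i}` with `c_i ∈ ℂ`. -/
theorem stmt1 (c : ℕ → ℂ) (hc0 : c 0 = 1) (C : LaurentSeries K)
    (hC : C = HahnSeries.ofPowerSeries ℤ K
      (PowerSeries.mk fun m =>
        if 3 ∣ m then algebraMap ℂ K (c (m / 3)) * u⁻¹ ^ (2 * (m / 3)) else 0))
    (heq : Sy (Sy C) = ySh (-2) C) :
    C = A := by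
  have hu : (u⁻¹ : K) ≠ 0 := inv_ne_zero RatFunc.X_ne_zero
  have hrec (k : ℕ) : c (k + 1) = -((6 * k + 5) * (6 * k + 1) / (24 * (k + 1))) * c k := by
    have h := coeff_recurrence heq (3 * (k : ℤ))
    have h3 : 3 * (k : ℤ) + 3 = 3 * ((k + 1 : ℕ) : ℤ) := by push_cast; ring
    rw [h3, hC, coeff_three_mul, coeff_three_mul] at h
    push_cast at h
    have hK : algebraMap ℂ K ((3 * k + 5 / 2) * (3 * k + 1 / 2) * c k
        + 6 * (k + 1) * c (k + 1)) = algebraMap ℂ K 0 := by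
      apply mul_left_cancel₀ (pow_ne_zero (2 * (k + 1)) hu)
      simp only [map_add, map_mul, map_div₀, map_natCast, map_ofNat, map_one, map_zero]
      linear_combination h
    have hk := (algebraMap ℂ K).injective hK
    have hk0 : (k : ℂ) + 1 ≠ 0 := by exact_mod_cast k.succ_ne_zero
    field_simp
    linear_combination 4 * hk
  have hc (k : ℕ) : c k = (aQ k : ℂ) := by
    induction k with
    | zero => simp [hc0, aQ]
    | succ k ih =>
      rw [hrec, aQ_succ, ih]
      push_cast
      ring
  rw [hC, A, mkS]
  simp only [hc, map_ratCast]

end
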